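/- Assume there exists a Luzin set of reals of cardinality ω₁. Then every compact Hausdorff space with a small diagonal has a point that is a G_δ point. -/

import Mathlib

open Set Cardinal

/-- A topological space has a small diagonal if every uncountable subset of `X × X`
disjoint from the diagonal has an uncountable subset whose closure is disjoint
from the diagonal. -/
def HasSmallDiagonal (X : Type*) [TopologicalSpace X] : Prop :=
  ∀ S : Set (X × X), ¬ S.Countable → (∀ p ∈ S, p.1 ≠ p.2) →
    ∃ T ⊆ S, ¬ T.Countable ∧ ∀ p ∈ closure T, p.1 ≠ p.2

/-- Well-founded recursion making a choice that satisfies `R` whenever one exists. -/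
theorem exists_recursive_choice {I D : Type*} [Preorder I] [WellFoundedLT I] [Nonempty D]
    (R : I → (I → D) → D → Prop)
    (hR : ∀ α f f' z, (∀ β < α, f β = f' β) → R α f z → R α f' z) :
    ∃ d : I → D, ∀ α, (∃ z, R α d z) → R α d (d α) := by
  classical
  let z₀ : D := Classical.arbitrary D
  let d : I → D := (wellFounded_lt (α := I)).fix fun α d =>
    Classical.epsilon fun z => R α (fun β => if h : β < α then d β h else z₀) z
  have hd (α : I) : d α =
      Classical.epsilon fun z => R α (fun β => if β < α then d β else z₀) z :=
    (wellFounded_lt (α := I)).fix_eq _ α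
  refine ⟨d, fun α ⟨z, hz⟩ => ?_⟩
  have hz' : ∃ z, R α (fun β => if β < α then d β else z₀) z :=
    ⟨z, hR α _ _ z (fun β hβ => by simp [hβ]) hz⟩
  have := Classical.epsilon_spec hz'
  rw [← hd α] at this
  exact hR α _ _ _ (fun β hβ => by simp [hβ]) this

theorem exists_coherent_finiteToOne {I : Type*} [LinearOrder I] [WellFoundedLT I]
    (hI : ∀ α : I, (Iio α).Countable) :
    ∃ e : I → I → ℕ, (∀ α m, {ξ | ξ < α ∧ e α ξ ≤ m}.Finite) ∧
      ∀ β α, β ≤ α → {ξ | ξ < β ∧ e α ξ ≠ e β ξ}.Finite := by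
  obtain ⟨e, he⟩ := exists_recursive_choice
    (fun (α : I) (e : I → I → ℕ) (f : I → ℕ) => (∀ m, {ξ | ξ < α ∧ f ξ ≤ m}.Finite) ∧
      ∀ β < α, {ξ | ξ < β ∧ f ξ ≠ e β ξ}.Finite)
    (fun α f f' z h hz => ⟨hz.1, fun β hβ => by rw [← h β hβ]; exact hz.2 β hβ⟩)
  have key (α : I) : (∀ m, {ξ | ξ < α ∧ e α ξ ≤ m}.Finite) ∧
      ∀ β < α, {ξ | ξ < β ∧ e α ξ ≠ e β ξ}.Finite := by
    induction α using WellFoundedLT.induction with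
    | ind α ih =>
    apply he
    obtain ⟨c, hc⟩ := (countable_iff_exists_injOn.1 (hI α) : ∃ c : I → ℕ, InjOn c (Iio α))
    have hfin (m : ℕ) : {b | b < α ∧ c b ≤ m}.Finite := by
      refine Set.Finite.of_injOn (f := c) (t := Iic m) (fun b hb => hb.2)
        (hc.mono fun b hb => hb.1) (finite_Iic m)
    have hb (ξ : I) : ∃ b, ξ < α → b < α ∧ ξ ≤ b ∧ ∀ b', b' < α → ξ ≤ b' → c b ≤ c b' := by
      by_cases hξ : ξ < α
      · obtain ⟨b, ⟨hb, hb'⟩, hmin⟩ := exists_minimalFor_of_wellFoundedLT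
          (fun b => b < α ∧ ξ ≤ b) c ⟨ξ, hξ, le_rfl⟩
        refine ⟨b, fun _ => ⟨hb, hb', fun b' h h' => ?_⟩⟩
        by_contra! hlt
        exact absurd (hmin ⟨h, h'⟩ hlt.le) (not_le.2 hlt)
      · exact ⟨ξ, fun h => absurd h hξ⟩
    choose b hb using hb
    refine ⟨fun ξ => max (e (b ξ) ξ) (c (b ξ)), fun m => ?_, fun β hβ => ?_⟩
    · refine ((hfin m).biUnion (t := fun a => {ξ | ξ < a ∧ e a ξ ≤ m} ∪ {a})
        fun a ha => ((ih a ha.1).1 m).union (finite_singleton a)).subset ?_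
      rintro ξ ⟨hξ, hm⟩
      obtain ⟨h1, h2, -⟩ := hb ξ hξ
      simp only [mem_iUnion]
      refine ⟨b ξ, ⟨h1, (le_max_right _ _).trans hm⟩, ?_⟩
      rcases h2.lt_or_eq with h | h
      · exact Or.inl ⟨h, (le_max_left _ _).trans hm⟩
      · exact Or.inr h
    · have hcoh (a : I) (ha : a < α) : {ξ | ξ < a ∧ ξ < β ∧ e a ξ ≠ e β ξ}.Finite := by
        rcases lt_trichotomy a β with h | rfl | h
        · exact ((ih β hβ).2 a h).subset fun ξ hξ => ⟨hξ.1, hξ.2.2.symm⟩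
        · simp
        · exact ((ih a ha).2 β h).subset fun ξ hξ => hξ.2
      refine ((hfin (c β)).biUnion (t := fun a => {ξ | ξ < a ∧ e a ξ ≤ c a} ∪ {a} ∪
        {ξ | ξ < a ∧ ξ < β ∧ e a ξ ≠ e β ξ})
        fun a ha => (((ih a ha.1).1 _).union (finite_singleton a)).union (hcoh a ha.1)).subset ?_
      rintro ξ ⟨hξ, hne⟩
      obtain ⟨h1, h2, h3⟩ := hb ξ (hξ.trans hβ)
      simp only [mem_iUnion]
      refine ⟨b ξ, ⟨h1, h3 β hβ hξ.le⟩, ?_⟩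
      rcases h2.lt_or_eq with h | h
      · rcases le_total (e (b ξ) ξ) (c (b ξ)) with h' | h'
        · exact Or.inl (Or.inl ⟨h, h'⟩)
        · replace hne : max (e (b ξ) ξ) (c (b ξ)) ≠ e β ξ := hne
          rw [max_eq_left h'] at hne
          exact Or.inr ⟨h, hξ, hne⟩
      · exact Or.inl (Or.inr h)
  refine ⟨e, fun α => (key α).1, fun β α h => ?_⟩
  rcases h.lt_or_eq with h | rfl
  · exact (key α).2 β h
  · simp

/-- A coherent sequence of injections of the initial segments of `I` into `ℕ`: any two of them
differ at only finitely many points of the smaller domain. -/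
theorem exists_coherent_injOn {I : Type*} [LinearOrder I] [WellFoundedLT I]
    (hI : ∀ α : I, (Iio α).Countable) :
    ∃ e : I → I → ℕ, (∀ α, InjOn (e α) (Iio α)) ∧
      ∀ β α, β ≤ α → {ξ | ξ < β ∧ e α ξ ≠ e β ξ}.Finite := by
  obtain ⟨e, hfin, hcoh⟩ := exists_coherent_finiteToOne hI
  refine ⟨fun α ξ => Nat.pair (e α ξ) {η | η ≤ ξ ∧ e α η = e α ξ}.ncard, fun α => ?_,
    fun β α hβ => ?_⟩
  · have hlt {ξ ξ' : I} (h : ξ < ξ') (h' : ξ' < α) (heq : e α ξ = e α ξ') :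
        {η | η ≤ ξ ∧ e α η = e α ξ}.ncard < {η | η ≤ ξ' ∧ e α η = e α ξ'}.ncard := by
      refine ncard_lt_ncard ⟨fun η hη => ⟨hη.1.trans h.le, hη.2.trans heq⟩, fun hsub => ?_⟩
        ((hfin α (e α ξ')).subset fun η hη => ⟨hη.1.trans_lt h', hη.2.le⟩)
      exact absurd (hsub (a := ξ') ⟨le_rfl, rfl⟩).1 (not_le.2 h)
    intro ξ hξ ξ' hξ' h
    obtain ⟨h1, h2⟩ := Nat.pair_eq_pair.1 h
    rcases lt_trichotomy ξ ξ' with hl | rfl | hl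
    · exact absurd h2 (hlt hl hξ' h1).ne
    · rfl
    · exact absurd h2 (hlt hl hξ h1.symm).ne'
  · have hβfin (m : ℕ) : {ξ | ξ < β ∧ e β ξ = m}.Finite :=
      (hfin β m).subset fun ξ hξ => ⟨hξ.1, hξ.2.le⟩
    have hαfin (m : ℕ) : {ξ | ξ < β ∧ e α ξ = m}.Finite :=
      (hfin α m).subset fun ξ hξ => ⟨hξ.1.trans_le hβ, hξ.2.le⟩
    refine ((hcoh β α hβ).union ((hcoh β α hβ).biUnion
      (t := fun δ => {ξ | ξ < β ∧ e β ξ = e β δ} ∪ {ξ | ξ < β ∧ e α ξ = e α δ})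
      fun δ _ => (hβfin _).union (hαfin _))).subset ?_
    rintro ξ ⟨hξ, hne⟩
    by_contra hcon
    simp only [mem_union, mem_iUnion, mem_ofPred_eq, not_or, not_exists, not_and, not_not] at hcon
    obtain ⟨h1, h2⟩ := hcon
    refine hne ?_
    have h1 := h1 hξ
    suffices {η | η ≤ ξ ∧ e α η = e α ξ} = {η | η ≤ ξ ∧ e β η = e β ξ} by
      show Nat.pair _ _ = Nat.pair _ _
      rw [this, h1]
    ext η
    refine and_congr_right fun hη => ?_
    by_cases hd : e α η = e β η
    · rw [hd, h1]
    · have := h2 η ⟨hη.trans_lt hξ, hd⟩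
      exact ⟨fun h => absurd h.symm (this.2 hξ), fun h => absurd h.symm (this.1 hξ)⟩

/-- The parity of the integer part of `2 ^ n * x`, that is, the `n`-th binary digit of `x`. -/
noncomputable def binaryDigit (x : ℝ) (n : ℕ) : Bool := decide (Odd ⌊2 ^ n * x⌋)

theorem binaryDigit_eqOn_dyadic (m : ℕ) (k : ℤ) :
    ∃ s : ℕ → Bool, ∀ x : ℝ, ⌊2 ^ m * x⌋ = k → ∀ n ≤ m, binaryDigit x n = s n := by
  refine ⟨fun n => decide (Odd (k / 2 ^ (m - n))), fun x hx n hn => ?_⟩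
  have h : ⌊2 ^ n * x⌋ = k / 2 ^ (m - n) := by
    have h1 := Int.floor_div_natCast (2 ^ m * x) (2 ^ (m - n))
    rw [hx] at h1
    push_cast at h1
    rw [← h1]
    congr 1
    rw [eq_div_iff (by positivity), mul_right_comm, ← pow_add, Nat.add_sub_cancel' hn]
  rw [binaryDigit, h]

theorem exists_dyadic_binaryDigit_eq (m : ℕ) (k : ℤ) (p : ℕ → Bool) (M : ℕ) :
    ∃ k' : ℤ, ∀ x : ℝ, ⌊2 ^ (m + M) * x⌋ = k' →
      ⌊2 ^ m * x⌋ = k ∧ ∀ n, m < n → n ≤ m + M → binaryDigit x n = p n := by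
  induction M with
  | zero => exact ⟨k, fun x hx => ⟨hx, fun n h h' => by omega⟩⟩
  | succ M ih =>
    obtain ⟨k', hk'⟩ := ih
    refine ⟨2 * k' + if p (m + M + 1) then 1 else 0, fun x hx => ?_⟩
    have h : ⌊2 ^ (m + M) * x⌋ = k' := by
      have h1 := Int.floor_div_natCast (2 ^ (m + (M + 1)) * x) 2
      rw [hx] at h1
      have h2 : (2 : ℝ) ^ (m + (M + 1)) * x / ((2 : ℕ) : ℝ) = 2 ^ (m + M) * x := by
        push_cast; ring
      rw [h2] at h1
      rw [h1]
      split_ifs <;> push_cast <;> omega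
    refine ⟨(hk' x h).1, fun n h1 h2 => ?_⟩
    rcases h2.lt_or_eq with h2 | rfl
    · exact (hk' x h).2 n h1 (by omega)
    · rw [binaryDigit, hx]
      rw [← add_assoc]
      cases p (m + M + 1) <;> simp [parity_simps]

theorem exists_finset_cylinder_subset {I : Type*} {U : Set (I → Bool)} (hU : IsOpen U)
    {u : I → Bool} (hu : u ∈ U) : ∃ S : Finset I, ∀ u', (∀ i ∈ S, u' i = u i) → u' ∈ U := by
  obtain ⟨S, t, ht, hS⟩ := isOpen_pi_iff.1 hU u hu
  exact ⟨S, fun u' h => hS fun i hi => by rw [h i hi]; exact (ht i hi).2⟩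

theorem isOpen_cylinder {I : Type*} {S : Set I} (hS : S.Finite) (u : I → Bool) :
    IsOpen {u' : I → Bool | ∀ i ∈ S, u' i = u i} :=
  isOpen_set_pi (s := fun i => {u i}) hS fun _ _ => isOpen_discrete _

/-- Binary digits pull closed nowhere dense subsets of the Cantor set back to nowhere dense sets. -/
theorem isNowhereDense_preimage_binaryDigit {N : Set (ℕ → Bool)} (hN : IsClosed N)
    (hN' : interior N = ∅) : IsNowhereDense (binaryDigit ⁻¹' N) := by
  rw [IsNowhereDense, eq_empty_iff_forall_notMem]
  intro x hx
  obtain ⟨ε, hε, hball⟩ := Metric.isOpen_iff.1 isOpen_interior x hx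
  obtain ⟨m, hm⟩ := exists_pow_lt_of_lt_one hε (by norm_num : (1 / 2 : ℝ) < 1)
  obtain ⟨s, hs⟩ := binaryDigit_eqOn_dyadic m ⌊2 ^ m * x⌋
  have hO := isOpen_cylinder (finite_Iic m) s
  have : ¬ {u' : ℕ → Bool | ∀ i ∈ Iic m, u' i = s i} ⊆ N := fun h => by
    have : s ∈ interior N := interior_maximal h hO fun _ _ => rfl
    simp [hN'] at this
  obtain ⟨u, hu, huN⟩ := not_subset.1 this
  obtain ⟨T, hT⟩ := exists_finset_cylinder_subset hN.isOpen_compl huN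
  obtain ⟨k', hk'⟩ := exists_dyadic_binaryDigit_eq m ⌊2 ^ m * x⌋ u (T.sup id)
  set M := m + T.sup id
  have hp : (0 : ℝ) < 2 ^ M := by positivity
  have hpm : (0 : ℝ) < 2 ^ m := by positivity
  have hIoo : Ioo (k' / 2 ^ M : ℝ) ((k' + 1) / 2 ^ M) ⊆ {y | ⌊2 ^ M * y⌋ = k'} := by
    rintro y ⟨h1, h2⟩
    rw [div_lt_iff₀ hp] at h1
    rw [lt_div_iff₀ hp] at h2
    exact Int.floor_eq_iff.2 ⟨by linarith, by linarith⟩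
  have hdis (y : ℝ) (hy : ⌊2 ^ M * y⌋ = k') : binaryDigit y ∉ N := by
    refine hT _ fun i hi => ?_
    have hiM : i ≤ M := (Finset.le_sup (f := id) hi).trans (Nat.le_add_left _ _)
    rcases le_or_gt i m with him | him
    · rw [hs y (hk' y hy).1 i him, hu i him]
    · exact (hk' y hy).2 i him hiM
  obtain ⟨y, hy⟩ : (Ioo (k' / 2 ^ M : ℝ) ((k' + 1) / 2 ^ M)).Nonempty :=
    nonempty_Ioo.2 (by gcongr; linarith)
  have hyball : y ∈ closure (binaryDigit ⁻¹' N) := by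
    refine interior_subset (hball ?_)
    have h1 := (hk' y (hIoo hy)).1
    have h2 := Int.floor_eq_iff.1 h1
    have h3 := Int.floor_le ((2 : ℝ) ^ m * x)
    have h4 := Int.lt_floor_add_one ((2 : ℝ) ^ m * x)
    rw [Metric.mem_ball, Real.dist_eq]
    refine lt_of_lt_of_le ?_ hm.le
    rw [one_div, inv_pow, ← mul_lt_mul_iff_right₀ hpm, mul_inv_cancel₀ hpm.ne',
      ← abs_of_pos hpm, ← abs_mul, abs_lt]
    constructor <;> linarith [h2.1, h2.2]
  obtain ⟨z, hz, hzN⟩ := mem_closure_iff.1 hyball _ isOpen_Ioo hy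
  exact hdis z (hIoo hz) hzN

/-- If `r` is a Luzin family in the Cantor set, then only countably many finite modifications of the
copies of its members along `e` lie in a closed set with empty interior determined by the countable
set `J` of coordinates. -/
theorem countable_setOf_almost_eq_luzin {I κ : Type*} {J : Set I} (hJ : J.Countable)
    {e : I → ℕ} (he : InjOn e J) {N : Set (I → Bool)} (hN : IsClosed N) (hN' : interior N = ∅)
    (hNJ : DependsOn (· ∈ N) J) {r : κ → ℕ → Bool}
    (hr : ∀ M : Set (ℕ → Bool), IsClosed M → interior M = ∅ → {k | r k ∈ M}.Countable)
    (G : κ → I → Bool) :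
    {k | {ξ | ξ ∈ J ∧ G k ξ ≠ r k (e ξ)}.Finite ∧ G k ∈ N}.Countable := by
  classical
  let Φ (S V : Set I) (p : ℕ → Bool) (ξ : I) : Bool :=
    if ξ ∈ S then decide (ξ ∈ V) else p (e ξ)
  have hΦ (S V : Set I) : Continuous (Φ S V) := by
    refine continuous_pi fun ξ => ?_
    by_cases h : ξ ∈ S
    · simpa [Φ, h] using continuous_const
    · simpa [Φ, h] using continuous_apply (e ξ)
  have hfin := Set.countable_ofPred_finite_subset hJ
  have hcount (S V : Set I) (hS : S.Finite) : {k | r k ∈ Φ S V ⁻¹' N}.Countable := by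
    refine hr _ (hN.preimage (hΦ S V)) (eq_empty_iff_forall_notMem.2 fun p hp => ?_)
    obtain ⟨T, hT⟩ := exists_finset_cylinder_subset isOpen_interior hp
    have hQ : {ξ | ξ ∈ J ∧ (ξ ∈ S ∨ e ξ ∈ T)}.Finite := by
      have hT' : {ξ | ξ ∈ J ∧ e ξ ∈ T}.Finite :=
        Set.Finite.of_injOn (fun ξ hξ => hξ.2) (he.mono fun ξ hξ => hξ.1) T.finite_toSet
      exact (hS.union hT').subset fun ξ hξ => hξ.2.imp id fun h => ⟨hξ.1, h⟩
    have : ¬ {u | ∀ ξ ∈ {ξ | ξ ∈ J ∧ (ξ ∈ S ∨ e ξ ∈ T)}, u ξ = Φ S V p ξ} ⊆ N := fun h => by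
      have : Φ S V p ∈ interior N :=
        interior_maximal h (isOpen_cylinder hQ _) fun _ _ => rfl
      simp [hN'] at this
    obtain ⟨u, hu, huN⟩ := not_subset.1 this
    let q (n : ℕ) : Bool := if h : ∃ ξ, ξ ∈ J ∧ ξ ∉ S ∧ e ξ = n then u h.choose else p n
    have hq (ξ : I) (hξ : ξ ∈ J) (hS : ξ ∉ S) : q (e ξ) = u ξ := by
      have h : ∃ ξ', ξ' ∈ J ∧ ξ' ∉ S ∧ e ξ' = e ξ := ⟨ξ, hξ, hS, rfl⟩
      simp only [q, dif_pos h]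
      rw [he h.choose_spec.1 hξ h.choose_spec.2.2]
    have hqT (n : ℕ) (hn : n ∈ T) : q n = p n := by
      by_cases h : ∃ ξ, ξ ∈ J ∧ ξ ∉ S ∧ e ξ = n
      · obtain ⟨ξ, hξ, hξS, rfl⟩ := h
        rw [hq ξ hξ hξS, hu ξ ⟨hξ, Or.inr hn⟩]
        simp [Φ, hξS]
      · simp only [q, dif_neg h]
    have hqN : Φ S V q ∈ N := interior_subset (s := Φ S V ⁻¹' N) (hT q hqT)
    refine huN ((hNJ fun ξ hξ => ?_).mp hqN)
    by_cases h : ξ ∈ S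
    · rw [hu ξ ⟨hξ, Or.inl h⟩]
      simp [Φ, h]
    · simp [Φ, h, hq ξ hξ h]
  refine ((hfin.prod hfin).biUnion (t := fun SV _ => {k | r k ∈ Φ SV.1 SV.2 ⁻¹' N})
    fun SV h => hcount _ _ h.1.1).mono ?_
  rintro k ⟨hk, hkN⟩
  simp only [mem_iUnion]
  refine ⟨⟨{ξ | ξ ∈ J ∧ G k ξ ≠ r k (e ξ)}, {ξ | (ξ ∈ J ∧ G k ξ ≠ r k (e ξ)) ∧ G k ξ = true}⟩,
    ⟨⟨hk, fun _ h => h.1⟩, ⟨hk.subset fun _ h => h.1, fun _ h => h.1.1⟩⟩, ?_⟩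
  refine (hNJ fun ξ hξ => ?_).mp hkN
  by_cases h : G k ξ = r k (e ξ)
  · simp [Φ, h]
  · simp [Φ, h, hξ]

/-- The closure of an open subset of a Cantor cube is determined by countably many coordinates. -/
theorem exists_countable_dependsOn_closure {I : Type*} {W : Set (I → Bool)} (hW : IsOpen W) :
    ∃ J : Set I, J.Countable ∧ DependsOn (· ∈ closure W) J := by
  classical
  have hD (SV : Set I × Set I) : ∃ D : Finset I,
      (∃ w ∈ W, ∀ i ∈ SV.1, w i = decide (i ∈ SV.2)) →
      ∃ w ∈ W, (∀ i ∈ SV.1, w i = decide (i ∈ SV.2)) ∧ ∀ w', (∀ i ∈ D, w' i = w i) → w' ∈ W := by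
    by_cases h : ∃ w ∈ W, ∀ i ∈ SV.1, w i = decide (i ∈ SV.2)
    · obtain ⟨w, hw, hw'⟩ := h
      obtain ⟨D, hD⟩ := exists_finset_cylinder_subset hW hw
      exact ⟨D, fun _ => ⟨w, hw, hw', hD⟩⟩
    · exact ⟨∅, fun h' => absurd h' h⟩
  choose D hD using hD
  let step (J : Set I) : Set I :=
    J ∪ ⋃ SV ∈ {S | S.Finite ∧ S ⊆ J} ×ˢ {S | S.Finite ∧ S ⊆ J}, (D SV : Set I)
  let K (n : ℕ) : Set I := step^[n] ∅
  have hKs (n : ℕ) : K (n + 1) = step (K n) := Function.iterate_succ_apply' _ _ _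
  have hKc (n : ℕ) : (K n).Countable := by
    induction n with
    | zero => exact countable_empty
    | succ n ih =>
      rw [hKs]
      have := Set.countable_ofPred_finite_subset ih
      exact ih.union ((this.prod this).biUnion fun SV _ => (D SV).countable_toSet)
  have hKm : Monotone K := monotone_nat_of_le_succ fun n => by
    rw [hKs]; exact subset_union_left
  refine ⟨⋃ n, K n, countable_iUnion hKc, ?_⟩
  suffices ∀ u u' : I → Bool, (∀ i ∈ ⋃ n, K n, u i = u' i) → u ∈ closure W → u' ∈ closure W from
    fun u u' h => propext ⟨this u u' h, this u' u fun i hi => (h i hi).symm⟩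
  intro u u' h hu
  rw [mem_closure_iff]
  intro O hO hu'
  obtain ⟨T, hT⟩ := exists_finset_cylinder_subset hO hu'
  set S : Set I := {i | i ∈ T ∧ i ∈ ⋃ n, K n}
  have hS : S.Finite := T.finite_toSet.subset fun i hi => hi.1
  obtain ⟨n, hn⟩ : ∃ n, S ⊆ K n := by
    have hf (i : I) : ∃ n, i ∈ S → i ∈ K n := by
      by_cases hi : i ∈ S
      · exact (mem_iUnion.1 hi.2).imp fun n hn _ => hn
      · exact ⟨0, fun h => absurd h hi⟩
    choose f hf using hf
    obtain ⟨n, hn⟩ := (hS.image f).bddAbove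
    exact ⟨n, fun i hi => hKm (hn (mem_image_of_mem f hi)) (hf i hi)⟩
  obtain ⟨w₀, hw₀, hw₀W⟩ := mem_closure_iff.1 hu _ (isOpen_cylinder hS u) fun _ _ => rfl
  obtain ⟨w, -, hwS, hw⟩ := hD (S, {i | i ∈ S ∧ u i = true})
    ⟨w₀, hw₀W, fun i hi => by simp [hw₀ i hi, show i ∈ S from hi]⟩
  have hDK : (D (S, {i | i ∈ S ∧ u i = true}) : Set I) ⊆ K (n + 1) := by
    rw [hKs]
    refine subset_union_of_subset_right ?_ _
    exact subset_biUnion_of_mem (u := fun SV => (D SV : Set I))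
      (show (S, {i | i ∈ S ∧ u i = true}) ∈ {S | S.Finite ∧ S ⊆ K n} ×ˢ {S | S.Finite ∧ S ⊆ K n} from
      ⟨⟨hS, hn⟩, hS.subset fun _ h => h.1, fun _ h => hn h.1⟩)
  refine ⟨fun i => if i ∈ T ∧ i ∉ ⋃ n, K n then u' i else w i, hT _ fun i hi => ?_,
    hw _ fun i hi => ?_⟩
  · by_cases hiK : i ∈ ⋃ n, K n
    · have hiS : i ∈ S := ⟨hi, hiK⟩
      simp only [hiK, not_true, and_false, if_false]
      rw [hwS i hiS, ← h i hiK]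
      simp [hiS]
    · simp only [hi, hiK, not_false_eq_true, and_self, if_true]
  · have : i ∈ ⋃ n, K n := mem_iUnion.2 ⟨n + 1, hDK hi⟩
    simp only [this, not_true, and_false, if_false]

theorem exists_continuousMap_lt_zero_one_lt {X : Type*} [TopologicalSpace X] [CompactSpace X]
    [T2Space X] {x y : X} (h : x ≠ y) : ∃ g : C(X, ℝ), g x < 0 ∧ 1 < g y := by
  obtain ⟨f, hf0, hf1, -⟩ := exists_continuous_zero_one_of_isClosed
    (isClosed_singleton (x := x)) (isClosed_singleton (x := y)) (by simpa using h)
  refine ⟨⟨fun z => 3 * f z - 1, by fun_prop⟩, ?_, ?_⟩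
  · simp [hf0 (mem_singleton x)]
  · simp [hf1 (mem_singleton y)]
    norm_num

/-- In a compact space with a small diagonal, a single continuous function separates uncountably
many of any uncountable family of pairs of distinct points. -/
theorem HasSmallDiagonal.exists_continuousMap {X ι : Type*} [TopologicalSpace X] [CompactSpace X]
    [T2Space X] [Uncountable ι] (hX : HasSmallDiagonal X) {x y : ι → X} (h : ∀ i, x i ≠ y i) :
    ∃ g : C(X, ℝ), ¬ {i | g (x i) < 0 ∧ 1 < g (y i)}.Countable := by
  let P (i : ι) : X × X := (x i, y i)
  by_cases hS : (range P).Countable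
  · by_contra! hcon
    have : (⋃ p ∈ range P, P ⁻¹' {p}).Countable := by
      refine hS.biUnion ?_
      rintro _ ⟨i, rfl⟩
      obtain ⟨g, hg⟩ := exists_continuousMap_lt_zero_one_lt (h i)
      refine (hcon g).mono fun j hj => ?_
      obtain ⟨h1, h2⟩ := Prod.mk.inj (show P j = P i from hj)
      show g (x j) < 0 ∧ 1 < g (y j)
      rwa [h1, h2]
    refine not_countable_univ (this.mono fun i _ => ?_)
    simp only [mem_iUnion]
    exact ⟨P i, mem_range_self i, rfl⟩
  · obtain ⟨T, hTS, hT, hdiag⟩ := hX (range P) hS (by rintro _ ⟨i, rfl⟩; exact h i)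
    have hg (p : X × X) : ∃ g : C(X, ℝ), p.1 ≠ p.2 → g p.1 < 0 ∧ 1 < g p.2 := by
      by_cases hp : p.1 = p.2
      · exact ⟨0, fun h => absurd hp h⟩
      · exact (exists_continuousMap_lt_zero_one_lt hp).imp fun g hg _ => hg
    choose g hg using hg
    have hopen (p : X × X) : IsOpen {q : X × X | g p q.1 < 0 ∧ 1 < g p q.2} :=
      (isOpen_lt ((g p).continuous.comp continuous_fst) continuous_const).inter
      (isOpen_lt continuous_const ((g p).continuous.comp continuous_snd))
    obtain ⟨t, ht, hcov⟩ := isClosed_closure.isCompact.elim_nhds_subcover (s := closure T)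
      (fun p => {q : X × X | g p q.1 < 0 ∧ 1 < g p q.2})
      fun p hp => (hopen p).mem_nhds (hg p (hdiag p hp))
    by_contra! hcon
    refine hT (((t.countable_toSet.biUnion fun p _ => (hcon (g p)).image P)).mono fun q hq => ?_)
    have hq' := hcov (subset_closure hq)
    simp only [mem_iUnion] at hq' ⊢
    obtain ⟨p, hp, hpq⟩ := hq'
    obtain ⟨i, rfl⟩ := hTS hq
    exact ⟨p, hp, i, hpq, rfl⟩

theorem nonempty_biInter_of_forall_le {I X : Type*} [LinearOrder I] [TopologicalSpace X]
    [CompactSpace X] [Nonempty X] {C : I → Set X} (hC : ∀ i, IsClosed (C i)) {L : Set I}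
    (h : ∀ β ∈ L, (⋂ γ ∈ Iic β, C γ).Nonempty) : (⋂ β ∈ L, C β).Nonempty := by
  rcases L.eq_empty_or_nonempty with rfl | hL
  · simp
  have := hL.to_subtype
  have hcl (β : L) : IsClosed (⋂ γ ∈ Iic (β : I), C γ) := isClosed_biInter fun γ _ => hC γ
  obtain ⟨x, hx⟩ := IsCompact.nonempty_iInter_of_directed_nonempty_isCompact_isClosed
    (fun β : L => ⋂ γ ∈ Iic (β : I), C γ)
    (directed_of_isDirected_le fun β β' hβ => biInter_subset_biInter_left (Iic_subset_Iic.2 hβ))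
    (fun β => h β β.2) (fun β => (hcl β).isCompact) hcl
  refine ⟨x, mem_iInter₂.2 fun β hβ => ?_⟩
  exact mem_iInter₂.1 (mem_iInter.1 hx ⟨β, hβ⟩) β self_mem_Iic

theorem nonempty_biInter_of_succ {I X : Type*} [LinearOrder I] [WellFoundedLT I]
    [TopologicalSpace X] [CompactSpace X] [Nonempty X] {C : I → Set X} (hC : ∀ i, IsClosed (C i))
    {L : Set I} (hL : IsLowerSet L)
    (h : ∀ β ∈ L, (⋂ γ ∈ Iio β, C γ).Nonempty → (⋂ γ ∈ Iic β, C γ).Nonempty) :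
    (⋂ β ∈ L, C β).Nonempty := by
  refine nonempty_biInter_of_forall_le hC fun β => ?_
  induction β using WellFoundedLT.induction with
  | ind β ih =>
    exact fun hβ => h β hβ (nonempty_biInter_of_forall_le hC fun γ hγ =>
      ih γ hγ (hL (le_of_lt hγ) hβ))

theorem exists_finset_forall_fiber_meets {I X : Type*} [TopologicalSpace X] [CompactSpace X]
    [T2Space X] {κ : Type*} [Uncountable κ] (hX : HasSmallDiagonal X)
    (hG : ∀ x : X, ¬ IsGδ ({x} : Set X)) {J : Set I} (hJ : J.Countable)
    {e : I → ℕ} (he : InjOn e J) {r : κ → ℕ → Bool}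
    (hr : ∀ M : Set (ℕ → Bool), IsClosed M → interior M = ∅ → {k | r k ∈ M}.Countable)
    {F : (I → Bool) → Set X} (hF : IsClosed {p : (I → Bool) × X | p.2 ∈ F p.1})
    (hFJ : DependsOn F J) (hne : ∀ u, (F u).Nonempty) (hFG : ∀ u, IsGδ (F u)) :
    ∃ (g : C(X, ℝ)) (S : Finset I) (v : I → Bool), ↑S ⊆ J ∧
      ∀ u, (∀ i ∈ S, u i = v i) → (∃ x ∈ F u, g x ≤ 0) ∧ ∃ x ∈ F u, 1 ≤ g x := by
  classical
  let ρ (k : κ) (ξ : I) : Bool := r k (e ξ)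
  have hxy (k : κ) : ∃ x ∈ F (ρ k), ∃ y ∈ F (ρ k), x ≠ y := by
    obtain ⟨x, hx⟩ := hne (ρ k)
    by_contra! hcon
    refine hG x ?_
    rw [← (eq_singleton_iff_unique_mem (s := F (ρ k))).2 ⟨hx, fun y hy => hcon y hy x hx⟩]
    exact hFG _
  choose x hx y hy hxy using hxy
  obtain ⟨g, hg⟩ := hX.exists_continuousMap hxy
  let P₀ : Set (I → Bool) := Prod.fst '' {p : (I → Bool) × X | p.2 ∈ F p.1 ∧ g p.2 ≤ 0}
  let P₁ : Set (I → Bool) := Prod.fst '' {p : (I → Bool) × X | p.2 ∈ F p.1 ∧ 1 ≤ g p.2}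
  have hP₀ (u : I → Bool) : u ∈ P₀ ↔ ∃ x ∈ F u, g x ≤ 0 := by simp [P₀]
  have hP₁ (u : I → Bool) : u ∈ P₁ ↔ ∃ x ∈ F u, 1 ≤ g x := by simp [P₁]
  have hcl₀ : IsClosed P₀ :=
    ((hF.inter (isClosed_le (g.continuous.comp continuous_snd) continuous_const)).isCompact.image
      continuous_fst).isClosed
  have hcl₁ : IsClosed P₁ :=
    ((hF.inter (isClosed_le continuous_const (g.continuous.comp continuous_snd))).isCompact.image
      continuous_fst).isClosed
  have hdep : DependsOn (· ∈ P₀ ∩ P₁) J := fun u u' h => by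
    simp only [mem_inter_iff, hP₀, hP₁, hFJ h]
  have hint : (interior (P₀ ∩ P₁)).Nonempty := by
    rw [nonempty_iff_ne_empty]
    intro hempty
    refine hg ((countable_setOf_almost_eq_luzin hJ he (hcl₀.inter hcl₁) hempty hdep hr ρ).mono ?_)
    intro k hk
    refine ⟨by simp [ρ], (hP₀ _).2 ⟨x k, hx k, hk.1.le⟩, (hP₁ _).2 ⟨y k, hy k, hk.2.le⟩⟩
  obtain ⟨v, hv⟩ := hint
  obtain ⟨T, hT⟩ := exists_finset_cylinder_subset isOpen_interior hv
  refine ⟨g, T.filter (· ∈ J), v, fun i hi => (Finset.mem_filter.1 hi).2, fun u hu => ?_⟩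
  have hw : (fun i => if i ∈ J then u i else v i) ∈ P₀ ∩ P₁ := by
    refine interior_subset (hT _ fun i hi => ?_)
    by_cases hiJ : i ∈ J
    · simp [hiJ, hu i (Finset.mem_filter.2 ⟨hi, hiJ⟩)]
    · simp [hiJ]
  have hu' : u ∈ P₀ ∩ P₁ := (hdep fun i hi => by simp [hi]).mp hw
  exact ⟨(hP₀ u).1 hu'.1, (hP₁ u).1 hu'.2⟩

/-- The condition put on points `x` over `u` by the data `z = (g, S, v)` at the coordinate `β`:
if `u` agrees with `v` on `S`, then `u β` decides on which side of `g` the point `x` lies. -/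
def sideSet {I X : Type*} [TopologicalSpace X] (z : C(X, ℝ) × Finset I × (I → Bool)) (β : I)
    (u : I → Bool) : Set X :=
  {x | (∀ i ∈ z.2.1, u i = z.2.2 i) → if u β then 1 ≤ z.1 x else z.1 x ≤ 0}

theorem isClosed_graph_sideSet {I X : Type*} [TopologicalSpace X]
    (z : C(X, ℝ) × Finset I × (I → Bool)) (β : I) :
    IsClosed {p : (I → Bool) × X | p.2 ∈ sideSet z β p.1} := by
  have h1 : IsClosed {p : (I → Bool) × X | ¬ ∀ i ∈ z.2.1, p.1 i = z.2.2 i} :=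
    (((isOpen_cylinder z.2.1.finite_toSet z.2.2).preimage continuous_fst)).isClosed_compl
  have h2 (b : Bool) : IsClosed {p : (I → Bool) × X | p.1 β = b} :=
    isClosed_eq ((continuous_apply β).comp continuous_fst) continuous_const
  have h3 : IsClosed {p : (I → Bool) × X | 1 ≤ z.1 p.2} :=
    isClosed_le continuous_const (z.1.continuous.comp continuous_snd)
  have h4 : IsClosed {p : (I → Bool) × X | z.1 p.2 ≤ 0} :=
    isClosed_le (z.1.continuous.comp continuous_snd) continuous_const
  convert h1.union (((h2 true).inter h3).union ((h2 false).inter h4)) using 1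
  ext p
  simp only [sideSet, mem_ofPred_eq, mem_union, mem_inter_iff]
  generalize (∀ i ∈ z.2.1, p.1 i = z.2.2 i) = P
  by_cases h : P <;> cases p.1 β <;> simp [h]

theorem isClosed_sideSet {I X : Type*} [TopologicalSpace X]
    (z : C(X, ℝ) × Finset I × (I → Bool)) (β : I) (u : I → Bool) : IsClosed (sideSet z β u) :=
  (isClosed_graph_sideSet z β).preimage (Continuous.prodMk_right u)

theorem isGδ_sideSet {I X : Type*} [TopologicalSpace X]
    (z : C(X, ℝ) × Finset I × (I → Bool)) (β : I) (u : I → Bool) : IsGδ (sideSet z β u) := by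
  have h (s : Set ℝ) (hs : IsClosed s) : IsGδ (z.1 ⁻¹' s) := hs.isGδ.preimage z.1.continuous
  by_cases hu : ∀ i ∈ z.2.1, u i = z.2.2 i
  · cases hb : u β
    · convert h (Iic 0) isClosed_Iic using 1
      ext x
      simp [sideSet, hb, imp_iff_right hu]
    · convert h (Ici 1) isClosed_Ici using 1
      ext x
      simp [sideSet, hb, imp_iff_right hu]
  · convert IsGδ.univ (X := X) using 1
    exact eq_univ_of_forall fun x h => absurd h hu

theorem dependsOn_sideSet {I X : Type*} [TopologicalSpace X]
    (z : C(X, ℝ) × Finset I × (I → Bool)) (β : I) {J : Set I} (hz : ↑z.2.1 ⊆ J) (hβ : β ∈ J) :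
    DependsOn (sideSet z β) J := by
  intro u u' h
  have h1 : (∀ i ∈ z.2.1, u i = z.2.2 i) ↔ ∀ i ∈ z.2.1, u' i = z.2.2 i :=
    forall₂_congr fun i hi => by rw [h i (hz hi)]
  simp only [sideSet, h1, h β hβ]

theorem exists_sideSet_system {I X : Type*} [LinearOrder I] [WellFoundedLT I] [Uncountable I]
    (hI : ∀ α : I, (Iio α).Countable) [TopologicalSpace X] [CompactSpace X] [T2Space X]
    [Nonempty X] (hX : HasSmallDiagonal X) (hG : ∀ x : X, ¬ IsGδ ({x} : Set X))
    {e : I → I → ℕ} (he : ∀ α, InjOn (e α) (Iio α)) {r : I → ℕ → Bool}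
    (hr : ∀ M : Set (ℕ → Bool), IsClosed M → interior M = ∅ → {k | r k ∈ M}.Countable) :
    ∃ d : I → C(X, ℝ) × Finset I × (I → Bool), (∀ α, ↑(d α).2.1 ⊆ Iio α) ∧
      ∀ u, (⋂ β, sideSet (d β) β u).Nonempty := by
  obtain ⟨d, hd⟩ := exists_recursive_choice
    (fun (α : I) (d : I → C(X, ℝ) × Finset I × (I → Bool)) z => ↑z.2.1 ⊆ Iio α ∧
      ∀ u, (∀ i ∈ z.2.1, u i = z.2.2 i) →
        (∃ x ∈ ⋂ β ∈ Iio α, sideSet (d β) β u, z.1 x ≤ 0) ∧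
        ∃ x ∈ ⋂ β ∈ Iio α, sideSet (d β) β u, 1 ≤ z.1 x) (by
    intro α f f' z h hz
    have (u : I → Bool) :
        ⋂ β ∈ Iio α, sideSet (f β) β u = ⋂ β ∈ Iio α, sideSet (f' β) β u :=
      iInter₂_congr fun β hβ => by rw [h β hβ]
    simpa only [this] using hz)
  have hne {L : Set I} (hL : IsLowerSet L) (h : ∀ β ∈ L, ∀ u, (∀ i ∈ (d β).2.1, u i = (d β).2.2 i) →
      (∃ x ∈ ⋂ γ ∈ Iio β, sideSet (d γ) γ u, (d β).1 x ≤ 0) ∧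
        ∃ x ∈ ⋂ γ ∈ Iio β, sideSet (d γ) γ u, 1 ≤ (d β).1 x) (u : I → Bool) :
      (⋂ β ∈ L, sideSet (d β) β u).Nonempty := by
    refine nonempty_biInter_of_succ (fun i => isClosed_sideSet _ _ _) hL fun β hβ ⟨x, hx⟩ => ?_
    suffices ∃ x ∈ ⋂ γ ∈ Iio β, sideSet (d γ) γ u, x ∈ sideSet (d β) β u by
      obtain ⟨x, hx, hx'⟩ := this
      refine ⟨x, mem_iInter₂.2 fun γ hγ => ?_⟩
      rcases (mem_Iic.1 hγ).lt_or_eq with hlt | rfl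
      · exact mem_iInter₂.1 hx γ hlt
      · exact hx'
    by_cases hu : ∀ i ∈ (d β).2.1, u i = (d β).2.2 i
    · obtain ⟨⟨y, hy, hy0⟩, z, hz, hz1⟩ := h β hβ u hu
      cases hb : u β
      · exact ⟨y, hy, fun _ => by simpa [hb] using hy0⟩
      · exact ⟨z, hz, fun _ => by simpa [hb] using hz1⟩
    · exact ⟨x, hx, fun h => absurd h hu⟩
  have key (α : I) : ↑(d α).2.1 ⊆ Iio α ∧ ∀ u, (∀ i ∈ (d α).2.1, u i = (d α).2.2 i) →
      (∃ x ∈ ⋂ β ∈ Iio α, sideSet (d β) β u, (d α).1 x ≤ 0) ∧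
        ∃ x ∈ ⋂ β ∈ Iio α, sideSet (d β) β u, 1 ≤ (d α).1 x := by
    induction α using WellFoundedLT.induction with
    | ind α ih =>
    apply hd
    obtain ⟨g, S, v, hS, h⟩ := exists_finset_forall_fiber_meets hX hG (hI α) (he α) hr
      (F := fun u => ⋂ β ∈ Iio α, sideSet (d β) β u)
      (by
        simp only [mem_iInter, ofPred_forall]
        exact isClosed_biInter fun β _ => isClosed_graph_sideSet (d β) β)
      (fun u u' huu => iInter₂_congr fun β hβ => dependsOn_sideSet (d β) β
        ((ih β hβ).1.trans (Iio_subset_Iio (le_of_lt hβ))) hβ huu)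
      (hne (isLowerSet_Iio α) fun β hβ => (ih β hβ).2)
      (fun u => .biInter (hI α) fun β _ => isGδ_sideSet _ _ _)
    exact ⟨(g, S, v), hS, h⟩
  refine ⟨d, fun α => (key α).1, fun u => ?_⟩
  simpa using hne isLowerSet_univ (fun β _ => (key β).2) u

theorem exists_subset_Iio_of_countable {I : Type*} [LinearOrder I] [Uncountable I]
    (hI : ∀ α : I, (Iio α).Countable) {J : Set I} (hJ : J.Countable) : ∃ γ, J ⊆ Iio γ := by
  have h : (⋃ j ∈ J, Iic j).Countable := hJ.biUnion fun j _ => by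
    rw [← Iio_insert]
    exact (hI j).insert j
  obtain ⟨γ, hγ⟩ := (ne_univ_iff_exists_notMem _).1 fun h' =>
    not_countable_univ (h'.subst (motive := Set.Countable) h)
  simp only [mem_iUnion, mem_Iic, not_exists, not_le] at hγ
  exact ⟨γ, fun j hj => hγ j hj⟩

theorem not_minimal_of_sideSet_system.{u, v} {I E : Type u} {X : Type v}
    [LinearOrder I] [Uncountable I]
    (hI : ∀ α : I, (Iio α).Countable) [TopologicalSpace X] [CompactSpace X] [T2Space X]
    (hX : HasSmallDiagonal X) {e : I → I → ℕ} (he : ∀ α, InjOn (e α) (Iio α))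
    (hcoh : ∀ β α, β ≤ α → {ξ | ξ < β ∧ e α ξ ≠ e β ξ}.Finite) {r : I → ℕ → Bool}
    (hr : ∀ M : Set (ℕ → Bool), IsClosed M → interior M = ∅ → {k | r k ∈ M}.Countable)
    {d : I → C(X, ℝ) × Finset I × (I → Bool)} (hd : ∀ α, ↑(d α).2.1 ⊆ Iio α)
    [TopologicalSpace E] [CompactSpace E] {ρ : E → I → Bool} (hρ : Continuous ρ)
    (hρs : ρ.Surjective) {π : E → X} (hπ : Continuous π) (hE : ∀ k β, π k ∈ sideSet (d β) β (ρ k)) :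
    ¬ ∀ E₀ : Set E, E₀ ≠ Set.univ → IsClosed E₀ → ρ '' E₀ ≠ Set.univ := by
  classical
  intro hmin
  let G (α ξ : I) : Bool :=
    if ξ ∈ (d α).2.1 then (d α).2.2 ξ else if ξ < α then r α (e α ξ) else false
  have hGS (α ξ : I) (h : ξ ∈ (d α).2.1) : G α ξ = (d α).2.2 ξ := if_pos h
  have hSα (α : I) : α ∉ (d α).2.1 := fun h => lt_irrefl α (hd α h)
  have hGα (α : I) : G α α = false := by simp [G, hSα]
  choose x hx using fun α => hρs (G α)
  choose y hy using fun α => hρs (Function.update (G α) α true)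
  have hxg (α : I) : (d α).1 (π (x α)) ≤ 0 := by
    have := hE (x α) α
    rw [hx] at this
    simpa [hGα] using this fun ξ hξ => hGS α ξ hξ
  have hyg (α : I) : 1 ≤ (d α).1 (π (y α)) := by
    have := hE (y α) α
    rw [hy] at this
    have hagree (ξ : I) (hξ : ξ ∈ (d α).2.1) :
        Function.update (G α) α true ξ = (d α).2.2 ξ := by
      rw [Function.update_of_ne (ne_of_mem_of_not_mem hξ (hSα α)), hGS α ξ hξ]
    simpa using this hagree
  obtain ⟨g, hg⟩ := hX.exists_continuousMap (x := π ∘ x) (y := π ∘ y) fun α h => by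
    have h1 := hxg α
    have h2 := hyg α
    rw [show π (x α) = π (y α) from h] at h1
    linarith
  have hopen₀ : IsOpen {k : E | g (π k) < 0} := isOpen_lt (g.continuous.comp hπ) continuous_const
  have hopen₁ : IsOpen {k : E | 1 < g (π k)} := isOpen_lt continuous_const (g.continuous.comp hπ)
  set W := (ρ '' {k : E | g (π k) < 0}ᶜ)ᶜ
  set U := (ρ '' {k : E | 1 < g (π k)}ᶜ)ᶜ
  have hW : IsOpen W := (hopen₀.isClosed_compl.isCompact.image hρ).isClosed.isOpen_compl
  have hU : IsOpen U := (hopen₁.isClosed_compl.isCompact.image hρ).isClosed.isOpen_compl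
  have hWU : Disjoint W U := by
    rw [disjoint_left]
    intro p hpW hpU
    obtain ⟨k, rfl⟩ := hρs p
    have h1 : g (π k) < 0 := by
      by_contra h
      exact hpW ⟨k, h, rfl⟩
    have h2 : 1 < g (π k) := by
      by_contra h
      exact hpU ⟨k, h, rfl⟩
    linarith
  have hcl₀ := image_subset_closure_compl_image_compl_of_isOpen hρ hρs hmin hopen₀
  have hcl₁ := image_subset_closure_compl_image_compl_of_isOpen hρ hρs hmin hopen₁
  obtain ⟨J₀, hJ₀, hdep₀⟩ := exists_countable_dependsOn_closure hW
  obtain ⟨J₁, hJ₁, hdep₁⟩ := exists_countable_dependsOn_closure hU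
  obtain ⟨γ, hγ⟩ := exists_subset_Iio_of_countable hI (hJ₀.union hJ₁)
  replace hdep₀ := hdep₀.mono (subset_union_left.trans hγ)
  replace hdep₁ := hdep₁.mono (subset_union_right.trans hγ)
  have hint : interior (closure W ∩ closure U) = ∅ := by
    rw [interior_inter, ← disjoint_iff_inter_eq_empty]
    exact ((hWU.closure_right hW).mono_right interior_subset).closure_left isOpen_interior
      |>.mono_left interior_subset
  have hdep : DependsOn (· ∈ closure W ∩ closure U) (Iio γ) := fun u u' h =>
    congrArg₂ And (hdep₀ h) (hdep₁ h)
  have hcount := countable_setOf_almost_eq_luzin (hI γ) (he γ)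
    (isClosed_closure.inter isClosed_closure) hint hdep hr G
  refine hg ((hcount.union (hI γ)).mono fun α ⟨h0, h1⟩ => ?_)
  rcases lt_or_ge α γ with hαγ | hαγ
  · exact Or.inr hαγ
  refine Or.inl ⟨((d α).2.1.finite_toSet.union (hcoh γ α hαγ)).subset ?_, ?_, ?_⟩
  · rintro ξ ⟨hξ, hne⟩
    by_cases hS : ξ ∈ (d α).2.1
    · exact Or.inl hS
    · refine Or.inr ⟨hξ, fun h => hne ?_⟩
      simp [G, hS, lt_of_lt_of_le hξ hαγ, h]
  · rw [← hx α]
    exact hcl₀ (mem_image_of_mem ρ h0)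
  · have := hcl₁ (mem_image_of_mem ρ h1)
    rw [hy] at this
    refine (hdep₁ fun ξ hξ => ?_).mp this
    exact Function.update_of_ne (lt_of_lt_of_le hξ hαγ).ne _ _

theorem HasSmallDiagonal.exists_isGδ_singleton.{u} {I X : Type u} [LinearOrder I] [WellFoundedLT I]
    [Uncountable I] (hI : ∀ α : I, (Iio α).Countable) {r : I → ℕ → Bool}
    (hr : ∀ M : Set (ℕ → Bool), IsClosed M → interior M = ∅ → {k | r k ∈ M}.Countable)
    [TopologicalSpace X] [CompactSpace X] [T2Space X] [Nonempty X] (hX : HasSmallDiagonal X) :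
    ∃ x : X, IsGδ ({x} : Set X) := by
  by_contra! hG
  obtain ⟨e, he, hcoh⟩ := exists_coherent_injOn hI
  obtain ⟨d, hd, hne⟩ := exists_sideSet_system hI hX hG he hr
  let K : Set ((I → Bool) × X) := ⋂ β, {p | p.2 ∈ sideSet (d β) β p.1}
  have hK : IsClosed K := isClosed_iInter fun β => isClosed_graph_sideSet (d β) β
  have : CompactSpace K := isCompact_iff_compactSpace.1 hK.isCompact
  let f (p : K) : I → Bool := p.1.1
  have hf : Continuous f := continuous_fst.comp continuous_subtype_val
  have hfs : f.Surjective := fun u => by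
    obtain ⟨x, hx⟩ := hne u
    exact ⟨⟨(u, x), mem_iInter.2 fun β => mem_iInter.1 hx β⟩, rfl⟩
  obtain ⟨E, hE, hEs, hmin⟩ := exists_compact_surjective_zorn_subset hf hfs
  refine not_minimal_of_sideSet_system hI hX he hcoh hr hd
    (ρ := E.domRestrict f) (hf.comp continuous_subtype_val) (fun u => ?_)
    (π := fun k => k.1.1.2) (by fun_prop) (fun k β => mem_iInter.1 k.1.2 β) hmin
  obtain ⟨k, hk, rfl⟩ := hEs.symm ▸ mem_univ u
  exact ⟨⟨k, hk⟩, rfl⟩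

/-- A Luzin set of size `ω₁` yields a Luzin family in the Cantor set indexed by a well-order of
type `ω₁`. -/
theorem exists_luzin_family.{u} (hLuzin : ∃ L : Set ℝ, #L = Cardinal.aleph 1 ∧
      ∀ N : Set ℝ, IsNowhereDense N → (L ∩ N).Countable) :
    ∃ (I : Type u) (_ : LinearOrder I) (_ : WellFoundedLT I) (_ : Uncountable I)
      (r : I → ℕ → Bool), (∀ α : I, (Iio α).Countable) ∧
      ∀ M : Set (ℕ → Bool), IsClosed M → interior M = ∅ → {k | r k ∈ M}.Countable := by
  obtain ⟨L, hL, hLN⟩ := hLuzin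
  let I : Type u := (Cardinal.aleph 1).ord.ToType
  have hcard : #I = Cardinal.aleph 1 := mk_ord_toType _
  obtain ⟨l⟩ : Nonempty (I ≃ ULift.{u} L) := Cardinal.lift_mk_eq'.1 (by simp [hcard, hL])
  have hunc : Uncountable I := by
    rw [← Cardinal.aleph0_lt_mk_iff, hcard]
    exact Cardinal.aleph0_lt_aleph_one
  refine ⟨I, inferInstance, inferInstance, hunc, fun i => binaryDigit (l i).down, fun α => ?_,
    fun M hM hM' => ?_⟩
  · rw [← Cardinal.le_aleph0_iff_set_countable, ← Order.lt_succ_iff, Cardinal.succ_aleph0]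
    exact (mk_Iio_lt α (by simp [I])).trans_eq hcard
  · have h := hLN _ (isNowhereDense_preimage_binaryDigit hM hM')
    have hinj : Function.Injective fun i => ((l i).down : ℝ) :=
      Subtype.val_injective.comp (ULift.down_injective.comp l.injective)
    exact (h.preimage hinj).mono fun i hi =>
      (⟨(l i).down.2, hi⟩ : ((l i).down : ℝ) ∈ L ∩ binaryDigit ⁻¹' M)

/-- If there is a Luzin set of reals of cardinality ω₁, then every compact Hausdorff
space with a small diagonal has a G_δ point. -/
theorem exists_Gdelta_point_of_luzin
    (hLuzin : ∃ L : Set ℝ, #L = Cardinal.aleph 1 ∧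
      ∀ N : Set ℝ, IsNowhereDense N → (L ∩ N).Countable) :
    ∀ (X : Type*) [TopologicalSpace X] [CompactSpace X] [T2Space X] [Nonempty X],
      HasSmallDiagonal X → ∃ x : X, IsGδ ({x} : Set X) := by
  intro X _ _ _ _ hX
  obtain ⟨I, _, _, _, r, hI, hr⟩ := exists_luzin_family hLuzin
  exact hX.exists_isGδ_singleton hI hr
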